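/- Let a be a uniform base sequence. Then a real number r belongs to ℚ_a (viewing ℚ_a ⊆ ℝ) if and only if |r| has only finitely many nonzero digits with respect to a. Equivalently, ℚ_a = F ∪ (−F), where F is the set of nonnegative reals with finitely many nonzero digits. -/

import Mathlib

open Set Filter
open scoped ENNReal

/-- `a₀ a₁ ⋯ a_{n-1}` as a real number: the product of the first `n` terms of the
base sequence (the paper's `a₁ ⋯ a_n`, re-indexed from 0). -/
noncomputable def bProd (a : ℕ → ℕ) (n : ℕ) : ℝ := ∏ k ∈ Finset.range n, (a k : ℝ)

/-- The `n`-th digit (0-indexed; the paper's `(n+1)`-st digit) of the nonnegative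
real `r` in base `a`:  `r_n = ⌊a₁⋯a_n (r - ⌊r⌋)⌋ - a_n ⌊a₁⋯a_{n-1} (r - ⌊r⌋)⌋`. -/
noncomputable def digit (a : ℕ → ℕ) (r : ℝ) (n : ℕ) : ℤ :=
  ⌊bProd a (n + 1) * Int.fract r⌋ - (a n : ℤ) * ⌊bProd a n * Int.fract r⌋

/-- `j_a(r) = { n : r_n ≠ r_{n+1} }`. -/
def jSet (a : ℕ → ℕ) (r : ℝ) : Set ℕ := {n | digit a r n ≠ digit a r (n + 1)}

/-- An ideal of subsets of ℕ: closed under subsets and finite unions, containing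
all singletons (hence nonempty). -/
def IsIdeal (I : Set (Set ℕ)) : Prop :=
  (∀ ⦃x y : Set ℕ⦄, x ∈ I → y ⊆ x → y ∈ I) ∧
  (∀ ⦃x y : Set ℕ⦄, x ∈ I → y ∈ I → x ∪ y ∈ I) ∧
  (∀ n : ℕ, ({n} : Set ℕ) ∈ I)

/-- Translation invariance of a family of subsets of ℕ. -/
def TransInv (I : Set (Set ℕ)) : Prop :=
  ∀ x ∈ I, ({n | ∃ m ∈ x, n = m + 1} ∈ I) ∧ ({n | n + 1 ∈ x} ∈ I)

/-- A tall family: every infinite set of naturals has an infinite subset in the family. -/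
def TallIdeal (I : Set (Set ℕ)) : Prop :=
  ∀ x : Set ℕ, x.Infinite → ∃ y, y ⊆ x ∧ y.Infinite ∧ y ∈ I

/-- The base sequence `a` is adapted to `I` if `{n : a_n ≠ a_{n+1}} ∈ I`. -/
def AdaptedTo (a : ℕ → ℕ) (I : Set (Set ℕ)) : Prop := {n | a n ≠ a (n + 1)} ∈ I

/-- A lower semicontinuous submeasure on subsets of ℕ. -/
def IsLscSubmeasure (φ : Set ℕ → ℝ≥0∞) : Prop :=
  φ ∅ = 0 ∧
  (∀ ⦃x y : Set ℕ⦄, x ⊆ y → φ x ≤ φ y) ∧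
  (∀ x y : Set ℕ, φ (x ∪ y) ≤ φ x + φ y) ∧
  (∀ n : ℕ, 0 < φ {n} ∧ φ {n} < ⊤) ∧
  (∀ x : Set ℕ, φ x = ⨆ n : ℕ, φ (x ∩ {k | k < n}))

/-- `Exh(φ) = { x ⊆ ℕ : φ(x \ {0,…,n-1}) → 0 }`. -/
def Exh (φ : Set ℕ → ℝ≥0∞) : Set (Set ℕ) :=
  {x | Filter.Tendsto (fun n => φ (x \ {k | k < n})) Filter.atTop (nhds 0)}

/-- `pr(a)`: the set of primes dividing `a_n` for all but finitely many `n`. -/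
def prSet (a : ℕ → ℕ) : Set ℕ := {p | p.Prime ∧ ∀ᶠ n in Filter.atTop, p ∣ a n}

/-- A base sequence is uniform if every prime dividing some `a_n` divides `a_n`
for all but finitely many `n`. -/
def UniformBase (a : ℕ → ℕ) : Prop :=
  ∀ p : ℕ, p.Prime → (∃ n, p ∣ a n) → ∀ᶠ n in Filter.atTop, p ∣ a n

/-- `ℚ_a`, viewed as a set of real numbers: fractions `k/l` with every prime
divisor of `l` in `pr(a)`. -/
def Qa (a : ℕ → ℕ) : Set ℝ :=
  {r | ∃ (k : ℤ) (l : ℕ), 0 < l ∧ (∀ p : ℕ, p.Prime → p ∣ l → p ∈ prSet a) ∧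
    r = (k : ℝ) / (l : ℝ)}

/-- `H = { r ∈ ℝ : j_a(|r|) ∈ I }`. -/
def Hset (a : ℕ → ℕ) (I : Set (Set ℕ)) : Set ℝ := {r | jSet a |r| ∈ I}

/-- `ρ(r,s) = φ(j_a(|r-s|)) + |r-s|`. -/
noncomputable def rho (a : ℕ → ℕ) (φ : Set ℕ → ℝ≥0∞) (r s : ℝ) : ℝ :=
  (φ (jSet a |r - s|)).toReal + |r - s|

theorem bProd_eq_cast (a : ℕ → ℕ) (n : ℕ) :
    bProd a n = ((∏ k ∈ Finset.range n, a k : ℕ) : ℝ) := by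
  simp [bProd]

theorem bProd_succ (a : ℕ → ℕ) (n : ℕ) : bProd a (n + 1) = bProd a n * a n :=
  Finset.prod_range_succ _ _

theorem two_pow_le_bProd {a : ℕ → ℕ} (ha : ∀ n, 2 ≤ a n) (n : ℕ) : (2 : ℝ) ^ n ≤ bProd a n := by
  induction n with
  | zero => simp [bProd]
  | succ n ih =>
    have h : (2 : ℝ) ≤ a n := by exact_mod_cast ha n
    rw [pow_succ, bProd_succ]
    exact mul_le_mul ih h zero_le_two (le_trans (by positivity) ih)

theorem exists_dvd_prod_of_primes_mem_prSet (a : ℕ → ℕ) (l : ℕ) (hl : 0 < l)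
    (h : ∀ p : ℕ, p.Prime → p ∣ l → p ∈ prSet a) :
    ∃ N, l ∣ ∏ k ∈ Finset.range N, a k := by
  induction l using induction_on_primes with
  | zero => omega
  | one => exact ⟨0, one_dvd _⟩
  | prime_mul p l hp ih =>
    obtain ⟨N, hN⟩ := ih (Nat.pos_of_mul_pos_left hl)
      fun q hq hql => h q hq (hql.mul_left p)
    obtain ⟨n, hpn, hn⟩ :=
      ((h p hp (dvd_mul_right p l)).2.and (eventually_ge_atTop N)).exists
    refine ⟨n + 1, ?_⟩
    rw [Finset.prod_range_succ, mul_comm p]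
    exact mul_dvd_mul (hN.trans (Finset.prod_dvd_prod_of_subset _ _ _
      (Finset.range_subset_range.2 hn))) hpn

theorem digit_eq_zero_of_bProd_mul_fract_eq {a : ℕ → ℕ} {r : ℝ} {n : ℕ} {m : ℤ}
    (h : bProd a n * Int.fract r = m) : digit a r n = 0 := by
  have h' : bProd a (n + 1) * Int.fract r = ((a n * m : ℤ) : ℝ) := by
    rw [bProd_succ]
    push_cast
    rw [← h]
    ring
  rw [digit, h', h, Int.floor_intCast, Int.floor_intCast, sub_self]

theorem exists_bProd_mul_fract_eq_of_le {a : ℕ → ℕ} {r : ℝ} {N n : ℕ} (hn : N ≤ n)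
    (h : ∃ m : ℤ, bProd a N * Int.fract r = m) : ∃ m : ℤ, bProd a n * Int.fract r = m := by
  induction n, hn using Nat.le_induction with
  | base => exact h
  | succ n _ ih =>
    obtain ⟨m, hm⟩ := ih
    refine ⟨a n * m, ?_⟩
    rw [bProd_succ]
    push_cast
    rw [← hm]
    ring

/-- If all digits of `r` from position `N` on vanish, then scaling the fractional part of `r` by
the `N`-th partial product of the base gives an integer. -/
theorem bProd_mul_fract_eq_floor {a : ℕ → ℕ} (ha : ∀ n, 2 ≤ a n) {r : ℝ} {N : ℕ}
    (h : ∀ n, N ≤ n → digit a r n = 0) :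
    bProd a N * Int.fract r = ⌊bProd a N * Int.fract r⌋ := by
  have hpos : ∀ n, 0 < bProd a n := fun n => (by positivity : (0 : ℝ) < 2 ^ n).trans_le
    (two_pow_le_bProd ha n)
  have hfloor : ∀ n, N ≤ n →
      bProd a N * ⌊bProd a n * Int.fract r⌋ = bProd a n * ⌊bProd a N * Int.fract r⌋ := by
    intro n hn
    induction n, hn using Nat.le_induction with
    | base => rfl
    | succ n hn ih =>
      rw [sub_eq_zero.1 (h n hn), bProd_succ a n]
      push_cast
      linear_combination (a n : ℝ) * ih
  refine le_antisymm (not_lt.1 fun hlt => ?_) (Int.floor_le _)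
  set x : ℝ := bProd a N * Int.fract r - ⌊bProd a N * Int.fract r⌋ with hx
  have hx0 : 0 < x := sub_pos.2 hlt
  have hlim : Tendsto (fun n => bProd a n) atTop atTop :=
    tendsto_atTop_mono (two_pow_le_bProd ha) (tendsto_pow_atTop_atTop_of_one_lt one_lt_two)
  obtain ⟨n, hbig, hn⟩ :=
    ((hlim.eventually_gt_atTop (bProd a N / x)).and (eventually_ge_atTop N)).exists
  rw [div_lt_iff₀ hx0] at hbig
  have hlt' := mul_lt_mul_of_pos_left (Int.lt_floor_add_one (bProd a n * Int.fract r)) (hpos N)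
  have hf := hfloor n hn
  rw [hx] at hbig
  linarith

theorem mem_Qa_neg_iff {a : ℕ → ℕ} {r : ℝ} : -r ∈ Qa a ↔ r ∈ Qa a := by
  have key : ∀ s : ℝ, s ∈ Qa a → -s ∈ Qa a := by
    rintro s ⟨k, l, hl, hp, rfl⟩
    exact ⟨-k, l, hl, hp, by push_cast; ring⟩
  exact ⟨fun h => neg_neg r ▸ key _ h, key r⟩

theorem mem_Qa_abs_iff {a : ℕ → ℕ} {r : ℝ} : |r| ∈ Qa a ↔ r ∈ Qa a := by
  rcases abs_choice r with h | h <;> rw [h]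
  exact mem_Qa_neg_iff

/-- for a uniform base sequence, `ℚ_a` (viewed inside ℝ) is exactly
the set of reals whose absolute value has finitely many nonzero digits. -/
theorem Qa_eq_finitely_many_nonzero_digits (a : ℕ → ℕ) (ha : ∀ n, 2 ≤ a n)
    (hu : UniformBase a) :
    ∀ r : ℝ, r ∈ Qa a ↔ {n | digit a |r| n ≠ 0}.Finite := by
  intro r
  rw [← mem_Qa_abs_iff]
  generalize |r| = s
  constructor
  · rintro ⟨k, l, hl, hp, hs⟩
    obtain ⟨N, c, hc⟩ := exists_dvd_prod_of_primes_mem_prSet a l hl hp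
    have hN : ∃ m : ℤ, bProd a N * Int.fract s = m := by
      refine ⟨c * k - l * c * ⌊s⌋, ?_⟩
      have hl' : (l : ℝ) ≠ 0 := by positivity
      have hls : (l : ℝ) * s = k := by rw [hs]; field_simp
      rw [bProd_eq_cast, hc, Int.fract]
      push_cast
      linear_combination (c : ℝ) * hls
    refine (Set.finite_lt_nat N).subset fun n hn => Set.mem_ofPred.2 (not_le.1 fun hle => hn ?_)
    obtain ⟨m, hm⟩ := exists_bProd_mul_fract_eq_of_le hle hN
    exact digit_eq_zero_of_bProd_mul_fract_eq hm
  · intro hfin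
    obtain ⟨M, hM⟩ := hfin.bddAbove
    have hN := bProd_mul_fract_eq_floor ha (r := s) (N := M + 1) fun n hn => by
      by_contra h
      have := hM h
      omega
    have hpos : 0 < ∏ k ∈ Finset.range (M + 1), a k :=
      Finset.prod_pos fun k _ => two_pos.trans_le (ha k)
    refine ⟨⌊bProd a (M + 1) * Int.fract s⌋ + (∏ k ∈ Finset.range (M + 1), a k : ℕ) * ⌊s⌋,
      ∏ k ∈ Finset.range (M + 1), a k, hpos, fun p hp hpd => ?_, ?_⟩
    · obtain ⟨k, -, hk⟩ := (hp.prime.dvd_finsetProd_iff _).1 hpd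
      exact ⟨hp, hu p hp ⟨k, hk⟩⟩
    · rw [eq_div_iff (by exact_mod_cast hpos.ne'), Int.cast_add, ← hN, bProd_eq_cast, Int.cast_mul,
        Int.cast_natCast, ← mul_add, Int.fract_add_floor, mul_comm]
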